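/- Let k ≥ 1, λ ∈ (0,1/2) and γ ∈ ℝ, and let (l_j) be a sequence as in the Cantor-type construction which additionally satisfies l_j − 2·l_{j+1} < l_{j−1} − 2·l_j for every j ≥ 1 and c₁·λ^j·j^γ ≤ l_j ≤ c₂·λ^j·j^γ for every j ≥ 1, for some constants 0 < c₁ ≤ c₂. Set 𝔇 = k·log 2 / log(1/λ). Then there exist C > 0 and t₀ ∈ (0,1/2) such that for every t ∈ (0,t₀), the k-dimensional Lebesgue measure of the neighbourhood {x ∈ ℝ^k : dist(x, 𝔠^k) < t} (Euclidean distance) is at most C·t^{k−𝔇}·(log(1/t))^{γ𝔇}. -/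

import Mathlib

open MeasureTheory Real

noncomputable section

/-- Left endpoint of the generation-`m` interval of the Cantor-type construction
selected by the sequence of bits `σ` (bit `i` chooses the right child at step `i`). -/
def cantorLeft (l : ℕ → ℝ) (m : ℕ) (σ : ℕ → Bool) : ℝ :=
  -(1 / 2) + ∑ i ∈ Finset.range m, (if σ i then l i - l (i + 1) else 0)

/-- The generation-`m` pre-Cantor set: the union of the `2^m` generation-`m` intervals. -/
def preCantor (l : ℕ → ℝ) (m : ℕ) : Set ℝ :=
  ⋃ σ : ℕ → Bool, Set.Icc (cantorLeft l m σ) (cantorLeft l m σ + l m)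

/-- The Cantor set associated with the sequence of lengths `l`. -/
def cantorSetL (l : ℕ → ℝ) : Set ℝ := ⋂ m, preCantor l m

/-- The `k`-fold Cartesian power `𝔠^k ⊆ ℝ^k` of the Cantor set. -/
def cantorCube (l : ℕ → ℝ) (k : ℕ) : Set (EuclideanSpace ℝ (Fin k)) :=
  {x | ∀ i, x i ∈ cantorSetL l}

open scoped ENNReal

/-- The neighbourhood of the pre-Cantor set obtained by enlarging each of its intervals by `t`. -/
def thickPreCantor (l : ℕ → ℝ) (m : ℕ) (t : ℝ) : Set ℝ :=
  ⋃ σ : ℕ → Bool, Set.Icc (cantorLeft l m σ - t) (cantorLeft l m σ + l m + t)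

lemma cantorLeft_congr (l : ℕ → ℝ) (m : ℕ) {σ τ : ℕ → Bool} (h : ∀ i < m, σ i = τ i) :
    cantorLeft l m σ = cantorLeft l m τ := by
  unfold cantorLeft
  congr 1
  refine Finset.sum_congr rfl fun i hi => ?_
  rw [h i (Finset.mem_range.1 hi)]

lemma volume_thickPreCantor_le (l : ℕ → ℝ) (m : ℕ) (t : ℝ) :
    volume (thickPreCantor l m t) ≤ 2 ^ m * ENNReal.ofReal (l m + 2 * t) := by
  let e : (Fin m → Bool) → ℕ → Bool := fun σ i => if h : i < m then σ ⟨i, h⟩ else false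
  have hsub : thickPreCantor l m t ⊆ ⋃ σ : Fin m → Bool,
      Set.Icc (cantorLeft l m (e σ) - t) (cantorLeft l m (e σ) + l m + t) := by
    refine Set.iUnion_subset fun σ => ?_
    have h : cantorLeft l m σ = cantorLeft l m (e fun i => σ i) :=
      cantorLeft_congr l m fun i hi => by simp [e, hi]
    rw [h]
    intro x hx
    exact Set.mem_iUnion.2 ⟨fun i => σ i, hx⟩
  calc volume (thickPreCantor l m t)
      ≤ ∑ σ : Fin m → Bool,
          volume (Set.Icc (cantorLeft l m (e σ) - t) (cantorLeft l m (e σ) + l m + t)) :=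
        (measure_mono hsub).trans (measure_iUnion_fintype_le volume _)
    _ = ∑ _σ : Fin m → Bool, ENNReal.ofReal (l m + 2 * t) := by
        refine Finset.sum_congr rfl fun σ _ => ?_
        rw [Real.volume_Icc]
        congr 1
        ring
    _ = 2 ^ m * ENNReal.ofReal (l m + 2 * t) := by
        rw [Finset.sum_const, Finset.card_univ, Fintype.card_fun, Fintype.card_bool,
          Fintype.card_fin, nsmul_eq_mul, Nat.cast_pow, Nat.cast_ofNat]

lemma cantorCube_nonempty (l : ℕ → ℝ) (hlpos : ∀ j, 0 < l j) (k : ℕ) :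
    (cantorCube l k).Nonempty := by
  refine ⟨WithLp.toLp 2 fun _ => -(1 / 2), fun i => Set.mem_iInter.2 fun m => ?_⟩
  refine Set.mem_iUnion.2 ⟨fun _ => false, ?_⟩
  simp [cantorLeft, (hlpos m).le]

lemma volume_euclidean_cube (k : ℕ) (S : Set ℝ) :
    volume {x : EuclideanSpace ℝ (Fin k) | ∀ i, x i ∈ S} = volume S ^ k := by
  have h := (EuclideanSpace.volume_preserving_symm_measurableEquiv_toLp (Fin k)).measure_preimage_equiv
    (Set.univ.pi fun _ => S)
  rw [volume_pi_pi, Finset.prod_const, Finset.card_univ, Fintype.card_fin] at h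
  rw [← h]
  congr 1
  ext x
  simp

lemma volume_neighbourhood_le (l : ℕ → ℝ) (hlpos : ∀ j, 0 < l j) (k m : ℕ) {t : ℝ} :
    volume {x : EuclideanSpace ℝ (Fin k) | Metric.infDist x (cantorCube l k) < t}
      ≤ (2 ^ m * ENNReal.ofReal (l m + 2 * t)) ^ k := by
  have hsub : {x : EuclideanSpace ℝ (Fin k) | Metric.infDist x (cantorCube l k) < t}
      ⊆ {x | ∀ i, x i ∈ thickPreCantor l m t} := by
    intro x hx i
    obtain ⟨y, hy, hxy⟩ := (Metric.infDist_lt_iff (cantorCube_nonempty l hlpos k)).1 hx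
    obtain ⟨σ, hσ⟩ := Set.mem_iUnion.1 (Set.mem_iInter.1 (hy i) m)
    have h1 : |x i - y i| ≤ dist x y := by
      simpa [dist_eq_norm] using PiLp.norm_apply_le (x - y) i
    have h2 := abs_le.1 (h1.trans hxy.le)
    exact Set.mem_iUnion.2 ⟨σ, by linarith [hσ.1], by linarith [hσ.2]⟩
  refine (measure_mono hsub).trans ?_
  rw [volume_euclidean_cube]
  exact pow_le_pow_left' (volume_thickPreCantor_le l m t) k

lemma length_le_half_pow {l : ℕ → ℝ} (hl0 : l 0 = 1) (hl2 : ∀ j, 2 * l (j + 1) < l j) (j : ℕ) :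
    l j ≤ (1 / 2) ^ j := by
  induction j with
  | zero => simp [hl0]
  | succ j ih => rw [pow_succ]; linarith [hl2 j]

/-- Powers, of either sign, of comparable positive quantities are comparable. -/
lemma rpow_le_of_comparable {a b γ : ℝ} (ha : 0 < a) (hb : 0 < b) {x y : ℝ} (hx : 0 < x)
    (hy : 0 < y) (hax : a * x ≤ y) (hyb : y ≤ b * x) :
    x ^ γ ≤ max (a ^ (-γ)) (b ^ (-γ)) * y ^ γ := by
  rcases le_total 0 γ with hγ | hγ
  · calc x ^ γ ≤ (a⁻¹ * y) ^ γ := by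
          refine Real.rpow_le_rpow hx.le ?_ hγ
          rw [inv_mul_eq_div, le_div_iff₀ ha]; linarith
      _ = a ^ (-γ) * y ^ γ := by
          rw [Real.mul_rpow (by positivity) hy.le, Real.inv_rpow ha.le, Real.rpow_neg ha.le]
      _ ≤ _ := by gcongr; exact le_max_left _ _
  · calc x ^ γ ≤ (b⁻¹ * y) ^ γ := by
          refine Real.rpow_le_rpow_of_nonpos (by positivity) ?_ hγ
          rw [inv_mul_eq_div, div_le_iff₀ hb]; linarith
      _ = b ^ (-γ) * y ^ γ := by
          rw [Real.mul_rpow (by positivity) hy.le, Real.inv_rpow hb.le, Real.rpow_neg hb.le]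
      _ ≤ _ := by gcongr; exact le_max_right _ _

/-- Scales between two consecutive lengths have logarithm comparable to the generation. -/
lemma log_inv_bounds {lam γ c₁ : ℝ} (hlam : lam ∈ Set.Ioo (0 : ℝ) (1 / 2)) (hc₁ : 0 < c₁)
    {l : ℕ → ℝ} (hl0 : l 0 = 1) (hl2 : ∀ j, 2 * l (j + 1) < l j)
    (hlow : ∀ j : ℕ, 1 ≤ j → c₁ * lam ^ j * (j : ℝ) ^ γ ≤ l j)
    {n : ℕ} (hn : 1 ≤ n) {t : ℝ} (ht : 0 < t) (hlt : l (n + 1) ≤ t) (htl : t < l n) :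
    Real.log 2 * n ≤ Real.log (1 / t) ∧
      Real.log (1 / t) ≤ 2 * (|Real.log c₁| + Real.log (1 / lam) + |γ|) * n := by
  have hn' : (1 : ℝ) ≤ n := by exact_mod_cast hn
  have hlog : Real.log (1 / t) = -Real.log t := by rw [one_div, Real.log_inv]
  have hloglam : Real.log (1 / lam) = -Real.log lam := by rw [one_div, Real.log_inv]
  have hlam0 : 0 < lam := hlam.1
  constructor
  · have h := Real.log_le_log ht (htl.le.trans (length_le_half_pow hl0 hl2 n))
    rw [Real.log_pow, one_div, Real.log_inv] at h
    rw [hlog]; linarith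
  · have hm : (0 : ℝ) < ((n + 1 : ℕ) : ℝ) := by positivity
    have h := Real.log_le_log (by positivity) ((hlow (n + 1) (by omega)).trans hlt)
    rw [Real.log_mul (by positivity) (by positivity), Real.log_mul (by positivity) (by positivity),
      Real.log_pow, Real.log_rpow hm] at h
    have hlogm0 : 0 ≤ Real.log ((n + 1 : ℕ) : ℝ) := Real.log_natCast_nonneg _
    have hlogm : Real.log ((n + 1 : ℕ) : ℝ) ≤ n := by
      have := Real.log_le_sub_one_of_pos hm
      push_cast at this ⊢; linarith
    have h1 : -(γ * Real.log ((n + 1 : ℕ) : ℝ)) ≤ |γ| * n := by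
      calc -(γ * Real.log ((n + 1 : ℕ) : ℝ)) = (-γ) * Real.log ((n + 1 : ℕ) : ℝ) := by ring
        _ ≤ |γ| * Real.log ((n + 1 : ℕ) : ℝ) := by gcongr; exact neg_le_abs γ
        _ ≤ |γ| * n := by gcongr
    have h2 : -Real.log c₁ ≤ |Real.log c₁| * n :=
      (neg_le_abs _).trans (le_mul_of_one_le_right (abs_nonneg _) hn')
    have h3 : 0 ≤ -Real.log lam := by
      linarith [Real.log_nonpos hlam0.le (by linarith [hlam.2])]
    have h4 : -(((n + 1 : ℕ) : ℝ) * Real.log lam) ≤ 2 * (-Real.log lam) * n := by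
      push_cast; nlinarith
    have h5 : 0 ≤ |Real.log c₁| * n := by positivity
    have h6 : 0 ≤ |γ| * n := by positivity
    rw [hlog, hloglam]
    linarith

lemma exists_consecutive_lengths {l : ℕ → ℝ} (hl0 : l 0 = 1) (hl2 : ∀ j, 2 * l (j + 1) < l j)
    {t : ℝ} (ht : 0 < t) (htl : t < l 1) : ∃ n, 1 ≤ n ∧ l (n + 1) ≤ t ∧ t < l n := by
  classical
  have hex : ∃ n, l (n + 1) ≤ t := by
    obtain ⟨n, hn⟩ := exists_pow_lt_of_lt_one ht (by norm_num : (1 / 2 : ℝ) < 1)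
    refine ⟨n, (length_le_half_pow hl0 hl2 _).trans (le_trans ?_ hn.le)⟩
    exact pow_le_pow_of_le_one (by norm_num) (by norm_num) (Nat.le_succ n)
  have hspec := Nat.find_spec hex
  rcases hfind : Nat.find hex with _ | n
  · rw [hfind] at hspec
    exact absurd hspec (not_le.2 htl)
  · rw [hfind] at hspec
    exact ⟨n + 1, by omega, hspec, not_le.1 (Nat.find_min hex (m := n) (by omega))⟩

/-- Lemma on the measure of neighbourhoods of generalized Cantor sets
`𝔠^k_{λ,γ}` (with `l_j ≍ λ^j j^γ`): for `𝔇 = k log 2 / log(1/λ)`, the Lebesgue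
measure of the `t`-neighbourhood of `𝔠^k` is `≲ t^{k-𝔇} (log(1/t))^{γ𝔇}`. -/
theorem statement8 (k : ℕ) (hk : 1 ≤ k) (lam γ : ℝ) (hlam : lam ∈ Set.Ioo (0 : ℝ) (1 / 2))
    (l : ℕ → ℝ) (hl0 : l 0 = 1) (hlpos : ∀ j, 0 < l j) (hl2 : ∀ j, 2 * l (j + 1) < l j)
    (hgap : ∀ j : ℕ, 1 ≤ j → l j - 2 * l (j + 1) < l (j - 1) - 2 * l j)
    (c₁ c₂ : ℝ) (hc₁ : 0 < c₁) (hc₁₂ : c₁ ≤ c₂)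
    (hlow : ∀ j : ℕ, 1 ≤ j → c₁ * lam ^ j * (j : ℝ) ^ γ ≤ l j)
    (hhigh : ∀ j : ℕ, 1 ≤ j → l j ≤ c₂ * lam ^ j * (j : ℝ) ^ γ) :
    ∃ C : ℝ, 0 < C ∧ ∃ t₀ ∈ Set.Ioo (0 : ℝ) (1 / 2), ∀ t ∈ Set.Ioo (0 : ℝ) t₀,
      volume {x : EuclideanSpace ℝ (Fin k) | Metric.infDist x (cantorCube l k) < t}
        ≤ ENNReal.ofReal
            (C * t ^ ((k : ℝ) - (k : ℝ) * Real.log 2 / Real.log (1 / lam))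
              * Real.log (1 / t) ^ (γ * ((k : ℝ) * Real.log 2 / Real.log (1 / lam)))) := by
  have hlam0 : 0 < lam := hlam.1
  have hlog2 : 0 < Real.log 2 := Real.log_pos one_lt_two
  have hloglam : 0 < Real.log (1 / lam) := by
    refine Real.log_pos ?_
    rw [lt_div_iff₀ hlam0]; linarith [hlam.2]
  have hc₂ : 0 < c₂ := hc₁.trans_le hc₁₂
  set b : ℝ := 2 * (|Real.log c₁| + Real.log (1 / lam) + |γ|) with hb_def
  have hb : 0 < b := by positivity
  set M : ℝ := max (Real.log 2 ^ (-γ)) (b ^ (-γ)) with hM_def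
  have hM : 0 < M := lt_max_of_lt_left (by positivity)
  set s : ℝ := Real.log 2 / Real.log (1 / lam) with hs_def
  have hs : 0 < s := by positivity
  have hpow (n : ℕ) : (2 : ℝ) ^ n = ((lam ^ n)⁻¹) ^ s := by
    have hbase : (2 : ℝ) = (lam⁻¹) ^ s := by
      rw [Real.rpow_def_of_pos (by positivity), ← one_div, hs_def, mul_div_cancel₀ _ hloglam.ne',
        Real.exp_log two_pos]
    rw [← inv_pow, ← Real.rpow_natCast_mul (by positivity), mul_comm (n : ℝ) s,
      Real.rpow_mul_natCast (by positivity), ← hbase]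
  refine ⟨(6 * (c₂ * M) ^ s) ^ k, by positivity, l 1,
    ⟨hlpos 1, by linarith [hl2 0]⟩, fun t ht => ?_⟩
  obtain ⟨ht0, ht1⟩ := ht
  obtain ⟨n, hn, hlt, htl⟩ := exists_consecutive_lengths hl0 hl2 ht0 ht1
  obtain ⟨hL1, hL2⟩ := log_inv_bounds hlam hc₁ hl0 hl2 hlow hn ht0 hlt htl
  have hn0 : (0 : ℝ) < n := by exact_mod_cast hn
  set L : ℝ := Real.log (1 / t) with hL_def
  have hL : 0 < L := lt_of_lt_of_le (by positivity) hL1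
  have hnγ : (n : ℝ) ^ γ ≤ M * L ^ γ := rpow_le_of_comparable hlog2 hb hn0 hL hL1 hL2
  have hlamn : (lam ^ n)⁻¹ ≤ c₂ * M * (t⁻¹ * L ^ γ) := by
    have h1 : t ≤ lam ^ n * (c₂ * (M * L ^ γ)) := by
      calc t ≤ c₂ * lam ^ n * (n : ℝ) ^ γ := htl.le.trans (hhigh n hn)
        _ ≤ c₂ * lam ^ n * (M * L ^ γ) := by gcongr
        _ = _ := by ring
    rw [inv_le_iff_one_le_mul₀ (by positivity)]
    calc (1 : ℝ) = t⁻¹ * t := (inv_mul_cancel₀ ht0.ne').symm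
      _ ≤ t⁻¹ * (lam ^ n * (c₂ * (M * L ^ γ))) := by gcongr
      _ = _ := by ring
  have h2n : (2 : ℝ) ^ (n + 1) ≤ 2 * (c₂ * M) ^ s * (t ^ (-s) * L ^ (γ * s)) := by
    calc (2 : ℝ) ^ (n + 1) = 2 * ((lam ^ n)⁻¹) ^ s := by rw [pow_succ, hpow]; ring
      _ ≤ 2 * (c₂ * M * (t⁻¹ * L ^ γ)) ^ s := by gcongr
      _ = _ := by
        rw [Real.mul_rpow (by positivity) (by positivity),
          Real.mul_rpow (x := t⁻¹) (by positivity) (by positivity), Real.inv_rpow ht0.le,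
          ← Real.rpow_neg ht0.le, ← Real.rpow_mul hL.le]
        ring
  have hexp : (6 * (c₂ * M) ^ s) ^ k * t ^ ((k : ℝ) - k * Real.log 2 / Real.log (1 / lam))
      * L ^ (γ * (k * Real.log 2 / Real.log (1 / lam)))
      = (2 * (c₂ * M) ^ s * (t ^ (-s) * L ^ (γ * s)) * (3 * t)) ^ k := by
    have e1 : (k : ℝ) - k * Real.log 2 / Real.log (1 / lam) = (-s + 1) * k := by
      rw [hs_def]; ring
    have e2 : γ * (k * Real.log 2 / Real.log (1 / lam)) = (γ * s) * k := by
      rw [hs_def]; ring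
    rw [e1, e2, Real.rpow_mul_natCast ht0.le, Real.rpow_mul_natCast hL.le,
      Real.rpow_add_one ht0.ne', ← mul_pow, ← mul_pow]
    ring
  rw [hexp]
  refine (volume_neighbourhood_le l hlpos k (n + 1)).trans ?_
  have h2 : (2 : ℝ≥0∞) ^ (n + 1) = ENNReal.ofReal (2 ^ (n + 1)) := by
    rw [ENNReal.ofReal_pow zero_le_two, ENNReal.ofReal_ofNat]
  rw [h2, ← ENNReal.ofReal_mul (by positivity), ENNReal.ofReal_pow (by positivity)]
  refine pow_le_pow_left' (ENNReal.ofReal_le_ofReal ?_) k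
  have h3 : l (n + 1) + 2 * t ≤ 3 * t := by linarith
  have h4 : 0 ≤ l (n + 1) + 2 * t := by linarith [hlpos (n + 1)]
  gcongr

end
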